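/- Let X ⊆ ℝ, let f : X → X be Borel measurable, and let μ be an f-invariant ergodic Borel probability measure on X. Then there exists a set X̃ in the Borel σ-algebra of X with μ(X̃) = 1 and f(X̃) ⊆ X̃ such that for every x ∈ X̃ the limit α(x) := lim_{d→∞} i_{d,d}(x)/d exists, α(x) = μ({y ∈ X̃ : y ≤ x}) for all x ∈ X̃, and α is injective on X̃. -/

import Mathlib

open MeasureTheory Filter Set Function
open scoped Classical ENNReal Topology

noncomputable section

/-- `ordIdx f d l x` is the inversion number `i_{d,l}(x)`, the `l`-th entry of the
ordinal pattern of order `d` realized by `x`: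
`i_{d,l}(x) = #{r ∈ {0,…,l-1} : f^[d-r] x ≤ f^[d-l] x}`. -/
def ordIdx {X : Set ℝ} (f : X → X) (d l : ℕ) (x : X) : ℕ :=
  ((Finset.range l).filter (fun r => f^[d - r] x ≤ f^[d - l] x)).card

section BirkhoffErgodic

variable {Ω : Type*}

/-- `birkhoffMax f g n x` is the maximum of the Birkhoff sums `birkhoffSum f g k x` over
`1 ≤ k ≤ n + 1`. -/
def birkhoffMax (f : Ω → Ω) (g : Ω → ℝ) : ℕ → Ω → ℝ
  | 0 => g
  | n + 1 => fun x => g x + max 0 (birkhoffMax f g n (f x))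

theorem birkhoffMax_succ (f : Ω → Ω) (g : Ω → ℝ) (n : ℕ) (x : Ω) :
    birkhoffMax f g (n + 1) x = g x + max 0 (birkhoffMax f g n (f x)) := rfl

theorem birkhoffMax_le_succ (f : Ω → Ω) (g : Ω → ℝ) (n : ℕ) (x : Ω) :
    birkhoffMax f g n x ≤ birkhoffMax f g (n + 1) x := by
  induction n generalizing x with
  | zero => simp [birkhoffMax]
  | succ n ih =>
    rw [birkhoffMax_succ, birkhoffMax_succ f g (n + 1)]
    gcongr
    exact ih (f x)

theorem monotone_birkhoffMax (f : Ω → Ω) (g : Ω → ℝ) (x : Ω) :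
    Monotone fun n => birkhoffMax f g n x :=
  monotone_nat_of_le_succ fun n => birkhoffMax_le_succ f g n x

theorem birkhoffSum_succ_le_birkhoffMax (f : Ω → Ω) (g : Ω → ℝ) (n : ℕ) (x : Ω) :
    birkhoffSum f g (n + 1) x ≤ birkhoffMax f g n x := by
  induction n generalizing x with
  | zero => simp [birkhoffMax]
  | succ n ih =>
    rw [birkhoffSum_succ', birkhoffMax_succ]
    gcongr
    exact (ih (f x)).trans (le_max_right _ _)

variable [MeasurableSpace Ω] {μ : Measure Ω} {f : Ω → Ω} {g : Ω → ℝ}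

theorem measurable_birkhoffMax (hf : Measurable f) (hg : Measurable g) (n : ℕ) :
    Measurable (birkhoffMax f g n) := by
  induction n with
  | zero => exact hg
  | succ n ih => exact hg.add (measurable_const.max (ih.comp hf))

theorem integrable_birkhoffMax (hf : MeasurePreserving f μ μ) (hg : Integrable g μ) (n : ℕ) :
    Integrable (birkhoffMax f g n) μ := by
  induction n with
  | zero => exact hg
  | succ n ih =>
    exact hg.add ((integrable_zero Ω ℝ μ).sup (hf.integrable_comp_of_integrable ih))

/-- If the Birkhoff maxima are unbounded almost everywhere, the function has nonnegative
integral. -/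
theorem integral_nonneg_of_ae_tendsto_birkhoffMax (hf : MeasurePreserving f μ μ)
    (hg : Integrable g μ)
    (h : ∀ᵐ x ∂μ, Tendsto (fun n => birkhoffMax f g n x) atTop atTop) :
    0 ≤ ∫ x, g x ∂μ := by
  have hint := integrable_birkhoffMax hf hg
  have hcomp n : Integrable (fun x => birkhoffMax f g n (f x)) μ :=
    hf.integrable_comp_of_integrable (hint n)
  have key (n : ℕ) (x : Ω) : birkhoffMax f g (n + 1) x - birkhoffMax f g n (f x)
      = g x - min 0 (birkhoffMax f g n (f x)) := by
    rw [birkhoffMax_succ]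
    linarith [min_add_max 0 (birkhoffMax f g n (f x))]
  have hlim : Tendsto
      (fun n => ∫ x, (birkhoffMax f g (n + 1) x - birkhoffMax f g n (f x)) ∂μ)
      atTop (𝓝 (∫ x, g x ∂μ)) := by
    refine tendsto_integral_of_dominated_convergence (fun x => |g x| + |g (f x)|)
      (fun n => ((hint (n + 1)).sub (hcomp n)).aestronglyMeasurable)
      (hg.abs.add (hcomp 0).abs) (fun n => ae_of_all _ fun x => ?_) ?_
    · rw [key, Real.norm_eq_abs]
      refine (abs_sub _ _).trans (add_le_add_right ?_ _)
      have h0 : g (f x) ≤ birkhoffMax f g n (f x) :=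
        monotone_birkhoffMax f g (f x) (Nat.zero_le n)
      rw [abs_of_nonpos (min_le_left _ _)]
      rcases min_cases 0 (birkhoffMax f g n (f x)) with h | h
      · simp [h.1]
      · linarith [neg_le_abs (g (f x)), h.1]
    · filter_upwards [hf.quasiMeasurePreserving.ae h] with x hx
      refine tendsto_const_nhds.congr' ?_
      filter_upwards [hx.eventually_ge_atTop 0] with n hn
      rw [key, min_eq_left hn, sub_zero]
  refine ge_of_tendsto' hlim fun n => ?_
  have hmap : ∫ x, birkhoffMax f g n (f x) ∂μ = ∫ x, birkhoffMax f g n x ∂μ := by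
    have hasm : AEStronglyMeasurable (birkhoffMax f g n) (μ.map f) := by
      rw [hf.map_eq]
      exact (hint n).aestronglyMeasurable
    rw [← integral_map hf.aemeasurable hasm, hf.map_eq]
  rw [integral_sub (hint _) (hcomp n), sub_nonneg, hmap]
  exact integral_mono (hint n) (hint _) fun x => birkhoffMax_le_succ f g n x

theorem Ergodic.ae_bddAbove_birkhoffMax [IsProbabilityMeasure μ] (hf : Ergodic f μ)
    (hgm : Measurable g) (hg : Integrable g μ) (hneg : ∫ x, g x ∂μ < 0) :
    ∀ᵐ x ∂μ, ∃ C, ∀ n, birkhoffMax f g n x ≤ C := by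
  set A : Set Ω := {x | ∀ K : ℕ, ∃ n, (K : ℝ) ≤ birkhoffMax f g n x} with hA
  have hAm : MeasurableSet A := by
    simp only [hA, ofPred_forall, ofPred_exists]
    exact .iInter fun K => .iUnion fun n =>
      measurableSet_le measurable_const (measurable_birkhoffMax hf.measurable hgm n)
  have hinv : f ⁻¹' A = A := by
    ext x
    simp only [hA, mem_preimage, mem_ofPred_eq]
    constructor
    · intro h K
      obtain ⟨L, hL⟩ := exists_nat_ge ((K : ℝ) - g x)
      obtain ⟨n, hn⟩ := h L
      refine ⟨n + 1, ?_⟩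
      rw [birkhoffMax_succ]
      linarith [le_max_right 0 (birkhoffMax f g n (f x))]
    · intro h K
      obtain ⟨L, hL⟩ := exists_nat_gt ((K : ℝ) + g x)
      obtain ⟨n, hn⟩ := h L
      have hn' := hn.trans (birkhoffMax_le_succ f g n x)
      rw [birkhoffMax_succ] at hn'
      have hmax : (K : ℝ) < max 0 (birkhoffMax f g n (f x)) := by linarith
      exact ⟨n, ((lt_max_iff.1 hmax).resolve_left (by simp)).le⟩
  rcases hf.ae_mem_or_ae_notMem hAm hinv with h | h
  · refine absurd (integral_nonneg_of_ae_tendsto_birkhoffMax hf.toMeasurePreserving hg ?_)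
      hneg.not_ge
    filter_upwards [h] with x hx
    refine tendsto_atTop_atTop_of_monotone (monotone_birkhoffMax f g x) fun b => ?_
    obtain ⟨K, hK⟩ := exists_nat_ge b
    obtain ⟨n, hn⟩ := hx K
    exact ⟨n, hK.trans hn⟩
  · filter_upwards [h] with x hx
    simp only [hA, mem_ofPred_eq, not_forall, not_exists, not_le] at hx
    obtain ⟨K, hK⟩ := hx
    exact ⟨K, fun n => (hK n).le⟩

theorem Ergodic.ae_eventually_birkhoffAverage_lt [IsProbabilityMeasure μ] (hf : Ergodic f μ)
    (hgm : Measurable g) (hg : Integrable g μ) {b : ℝ} (hb : ∫ x, g x ∂μ < b) :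
    ∀ᵐ x ∂μ, ∀ᶠ n in atTop, birkhoffAverage ℝ f g n x < b := by
  obtain ⟨c, hc, hcb⟩ := exists_between hb
  have hneg : ∫ x, (g x - c) ∂μ < 0 := by
    rw [integral_sub hg (integrable_const c)]
    simpa using hc
  filter_upwards [hf.ae_bddAbove_birkhoffMax (hgm.sub_const c)
    (hg.sub (integrable_const c)) hneg] with x ⟨C, hC⟩
  obtain ⟨N, hN⟩ := exists_nat_gt (C / (b - c))
  filter_upwards [eventually_ge_atTop (N + 1)] with n hn
  obtain ⟨m, rfl⟩ : ∃ m, n = m + 1 := ⟨n - 1, by omega⟩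
  have h := (birkhoffSum_succ_le_birkhoffMax f (fun x => g x - c) m x).trans (hC m)
  have hsum : birkhoffSum f (fun x => g x - c) (m + 1) x
      = birkhoffSum f g (m + 1) x - (m + 1 : ℕ) * c := by
    simp [birkhoffSum, Finset.sum_sub_distrib]
  have hpos : (0 : ℝ) < (m + 1 : ℕ) := by positivity
  have hNm : (N : ℝ) ≤ (m + 1 : ℕ) := by exact_mod_cast (by omega : N ≤ m + 1)
  rw [div_lt_iff₀ (sub_pos.2 hcb)] at hN
  rw [birkhoffAverage, smul_eq_mul, inv_mul_lt_iff₀ hpos]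
  have := mul_le_mul_of_nonneg_right hNm (sub_pos.2 hcb).le
  linarith

/-- **Birkhoff's pointwise ergodic theorem** for ergodic probability-preserving maps. -/
theorem Ergodic.ae_tendsto_birkhoffAverage [IsProbabilityMeasure μ] (hf : Ergodic f μ)
    (hgm : Measurable g) (hg : Integrable g μ) :
    ∀ᵐ x ∂μ, Tendsto (fun n => birkhoffAverage ℝ f g n x) atTop (𝓝 (∫ x, g x ∂μ)) := by
  have hupper {h : Ω → ℝ} (hhm : Measurable h) (hh : Integrable h μ) :
      ∀ᵐ x ∂μ, ∀ q : ℚ, ∫ x, h x ∂μ < q → ∀ᶠ n in atTop, birkhoffAverage ℝ f h n x < q := by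
    rw [ae_all_iff]
    intro q
    by_cases hq : ∫ x, h x ∂μ < q
    · filter_upwards [hf.ae_eventually_birkhoffAverage_lt hhm hh hq] with x hx _ using hx
    · exact ae_of_all _ fun x hx => absurd hx hq
  filter_upwards [hupper hgm hg, hupper hgm.neg hg.neg] with x h₁ h₂
  refine tendsto_order.2 ⟨fun a ha => ?_, fun b hb => ?_⟩
  · obtain ⟨q, hq, hqa⟩ := exists_rat_btwn (neg_lt_neg ha)
    filter_upwards [h₂ q (by simpa only [Pi.neg_apply, integral_neg] using hq)] with n hn
    rw [birkhoffAverage_neg] at hn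
    simp only [Pi.neg_apply] at hn
    linarith
  · obtain ⟨q, hq, hqb⟩ := exists_rat_btwn hb
    filter_upwards [h₁ q hq] with n hn using hn.trans hqb

end BirkhoffErgodic

/-- Monotone functions converging to `F` at all rational points and at all discontinuities of
`F` converge to `F` everywhere. -/
theorem tendsto_of_monotone_of_tendsto_rat {F : ℝ → ℝ} {G : ℕ → ℝ → ℝ}
    (hG : ∀ n, Monotone (G n))
    (hrat : ∀ q : ℚ, Tendsto (fun n => G n q) atTop (𝓝 (F q)))
    (hdisc : ∀ t, ¬ContinuousAt F t → Tendsto (fun n => G n t) atTop (𝓝 (F t))) (t : ℝ) :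
    Tendsto (fun n => G n t) atTop (𝓝 (F t)) := by
  by_cases hc : ContinuousAt F t
  · refine tendsto_order.2 ⟨fun a ha => ?_, fun b hb => ?_⟩
    · obtain ⟨l, hl, hlt⟩ := exists_Ioc_subset_of_mem_nhds
        (hc.eventually (lt_mem_nhds ha)) (exists_lt t)
      obtain ⟨q, hq, hqt⟩ := exists_rat_btwn hl
      filter_upwards [(hrat q).eventually (lt_mem_nhds (hlt ⟨hq, hqt.le⟩))] with n hn
      exact hn.trans_le (hG n hqt.le)
    · obtain ⟨u, hu, hut⟩ := exists_Ico_subset_of_mem_nhds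
        (hc.eventually (gt_mem_nhds hb)) (exists_gt t)
      obtain ⟨q, htq, hq⟩ := exists_rat_btwn hu
      filter_upwards [(hrat q).eventually (gt_mem_nhds (hut ⟨htq.le, hq⟩))] with n hn
      exact (hG n htq.le).trans_lt hn
  · exact hdisc t hc

section RealMeasure

variable {Ω : Type*} [MeasurableSpace Ω] {μ : Measure Ω}

theorem monotone_measureReal_le [IsFiniteMeasure μ] (φ : Ω → ℝ) :
    Monotone fun t : ℝ => μ.real {y | φ y ≤ t} :=
  fun _ _ hst => measureReal_mono fun _ hy => le_trans hy hst

theorem measure_lt_le_eq_zero [IsFiniteMeasure μ] {φ : Ω → ℝ} (hφ : Measurable φ) {s t : ℝ}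
    (hst : s ≤ t) (h : μ.real {y | φ y ≤ s} = μ.real {y | φ y ≤ t}) :
    μ {y | s < φ y ∧ φ y ≤ t} = 0 := by
  have hdiff : {y | s < φ y ∧ φ y ≤ t} = {y | φ y ≤ t} \ {y | φ y ≤ s} := by
    ext y
    simp [and_comm]
  have hsub : {y | φ y ≤ s} ⊆ {y | φ y ≤ t} := fun y hy => le_trans hy hst
  rw [← measureReal_eq_zero_iff, hdiff,
    measureReal_sdiff hsub (measurableSet_le hφ measurable_const), h, sub_self]

/-- Almost no point is the right end of an interval of constancy of the distribution function. -/
theorem ae_measureReal_le_ne_of_lt [IsFiniteMeasure μ] {φ : Ω → ℝ} (hφ : Measurable φ) :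
    ∀ᵐ y ∂μ, ∀ s < φ y, μ.real {z | φ z ≤ s} ≠ μ.real {z | φ z ≤ φ y} := by
  have hmono := monotone_measureReal_le (μ := μ) φ
  set F : ℝ → ℝ := fun t => μ.real {y | φ y ≤ t}
  have hq (q : ℚ) : ∀ᵐ y ∂μ, (q : ℝ) < φ y → F q ≠ F (φ y) := by
    rw [ae_iff]
    simp only [Classical.not_imp, not_not]
    by_cases hmax : ∃ m : ℝ, q < m ∧ F q = F m ∧ ∀ y, q < φ y → F q = F (φ y) → φ y ≤ m
    · obtain ⟨m, hqm, hFm, hm⟩ := hmax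
      refine measure_mono_null (fun y hy => ?_) (measure_lt_le_eq_zero hφ hqm.le hFm)
      exact ⟨hy.1, hm y hy.1 hy.2⟩
    · push Not at hmax
      have hnull : μ (⋃ r : {r : ℚ // q < r ∧ F q = F r}, {y | q < φ y ∧ φ y ≤ (r : ℚ)}) = 0 :=
        measure_iUnion_null fun r =>
          measure_lt_le_eq_zero hφ (by exact_mod_cast r.2.1.le) r.2.2
      refine measure_mono_null (fun y hy => ?_) hnull
      obtain ⟨z, hqz, hFz, hyz⟩ := hmax (φ y) hy.1 hy.2
      obtain ⟨r, hyr, hrz⟩ := exists_rat_btwn hyz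
      have hqr : (q : ℝ) < r := hy.1.trans hyr
      exact mem_iUnion.2 ⟨⟨r, by exact_mod_cast hqr,
        le_antisymm (hmono hqr.le) ((hmono hrz.le).trans_eq hFz.symm)⟩, hy.1, hyr.le⟩
  filter_upwards [ae_all_iff.2 hq] with y hy s hs heq
  obtain ⟨q, hsq, hqy⟩ := exists_rat_btwn hs
  exact hy q hqy (le_antisymm (hmono hqy.le) (heq.symm.trans_le (hmono hsq.le)))

/-- Along almost every orbit of an ergodic map, the empirical distribution functions of a real
observable converge everywhere. -/
theorem Ergodic.ae_forall_tendsto_birkhoffAverage_le [IsProbabilityMeasure μ] {f : Ω → Ω}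
    (hf : Ergodic f μ) {φ : Ω → ℝ} (hφ : Measurable φ) :
    ∀ᵐ x ∂μ, ∀ t : ℝ, Tendsto
      (fun n => birkhoffAverage ℝ f ({y | φ y ≤ t}.indicator 1) n x) atTop
      (𝓝 (μ.real {y | φ y ≤ t})) := by
  have hpt (t : ℝ) : ∀ᵐ x ∂μ, Tendsto
      (fun n => birkhoffAverage ℝ f ({y | φ y ≤ t}.indicator 1) n x) atTop
      (𝓝 (μ.real {y | φ y ≤ t})) := by
    have hs : MeasurableSet {y | φ y ≤ t} := measurableSet_le hφ measurable_const
    have := hf.ae_tendsto_birkhoffAverage (g := {y | φ y ≤ t}.indicator 1)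
      (measurable_one.indicator hs) ((integrable_const (1 : ℝ)).indicator hs)
    rwa [integral_indicator_one hs] at this
  have hcount := (monotone_measureReal_le (μ := μ) φ).countable_not_continuousAt
  filter_upwards [ae_all_iff.2 fun q : ℚ => hpt q, (ae_ball_iff hcount).2 fun t _ => hpt t]
    with x hrat hdisc
  refine tendsto_of_monotone_of_tendsto_rat
    (G := fun n t => birkhoffAverage ℝ f ({y | φ y ≤ t}.indicator 1) n x)
    (fun n s t hst => ?_) hrat hdisc
  have hind (y : Ω) : {y | φ y ≤ s}.indicator (1 : Ω → ℝ) y ≤ {y | φ y ≤ t}.indicator 1 y :=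
    indicator_le_indicator_apply_of_subset (fun y hy => le_trans hy hst) zero_le_one
  exact mul_le_mul_of_nonneg_left (Finset.sum_le_sum fun i _ => hind _) (by positivity)

end RealMeasure

theorem ordIdx_self_div {X : Set ℝ} (f : X → X) (d : ℕ) (x : X) :
    (ordIdx f d d x : ℝ) / d
      = birkhoffAverage ℝ f ({y : X | (y : ℝ) ≤ x}.indicator 1) d (f x) := by
  rw [birkhoffAverage, birkhoffSum, smul_eq_mul, div_eq_inv_mul, ordIdx, Finset.card_filter,
    ← Finset.sum_range_reflect]
  congr 1
  push_cast
  refine Finset.sum_congr rfl fun r hr => ?_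
  have hrd : d - (d - 1 - r) = r + 1 := by
    have := Finset.mem_range.1 hr
    omega
  simp [hrd, indicator_apply]

/-- In the ergodic case there is a Borel set `X̃ ⊆ X` of full measure with `f(X̃) ⊆ X̃`
on which `α(x) = lim_{d→∞} i_{d,d}(x)/d` exists, `α(x) = μ({y ∈ X̃ : y ≤ x})`, and `α`
is injective on `X̃`. -/
theorem exists_forward_invariant_full_measure_limit_ergodic
    {X : Set ℝ} (f : X → X) (μ : Measure X) [IsProbabilityMeasure μ]
    (hf : Ergodic f μ) :
    ∃ Xt : Set X, ∃ α : X → ℝ, MeasurableSet Xt ∧ μ Xt = 1 ∧ Set.MapsTo f Xt Xt ∧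
      (∀ x ∈ Xt,
        Tendsto (fun d : ℕ => (ordIdx f d d x : ℝ) / d) atTop (nhds (α x))) ∧
      (∀ x ∈ Xt, α x = (μ {y : X | y ∈ Xt ∧ y ≤ x}).toReal) ∧
      Set.InjOn α Xt := by
  obtain ⟨s, hs, hsm, hgood⟩ :=
    ((hf.quasiMeasurePreserving.ae
      (hf.ae_forall_tendsto_birkhoffAverage_le measurable_subtype_coe)).and
      (ae_measureReal_le_ne_of_lt (μ := μ) measurable_subtype_coe)).exists_measurable_mem
  have hXt : ∀ᵐ x ∂μ, x ∈ ⋂ n, f^[n] ⁻¹' s := by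
    simp only [mem_iInter, mem_preimage, ae_all_iff]
    exact fun n => (hf.quasiMeasurePreserving.iterate n).ae hs
  have hm : MeasurableSet (⋂ n, f^[n] ⁻¹' s) := .iInter fun n => hf.measurable.iterate n hsm
  have hsub : ⋂ n, f^[n] ⁻¹' s ⊆ s := iInter_subset _ 0
  refine ⟨⋂ n, f^[n] ⁻¹' s, fun x => μ.real {y : X | (y : ℝ) ≤ x},
    hm, (mem_ae_iff_prob_eq_one hm).1 hXt,
    fun x hx => ?_, fun x hx => ?_, fun x _ => ?_, fun x hx y hy hxy => ?_⟩
  · simp only [mem_iInter, mem_preimage] at hx ⊢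
    exact fun n => hx (n + 1)
  · simp only [ordIdx_self_div]
    exact (hgood x (hsub hx)).1 x
  · refine congrArg ENNReal.toReal (measure_congr ?_)
    filter_upwards [hXt] with y hy
    exact propext ⟨fun h => ⟨hy, h⟩, fun h => h.2⟩
  · rcases lt_trichotomy (x : ℝ) y with h | h | h
    · exact absurd hxy ((hgood y (hsub hy)).2 x h)
    · exact Subtype.ext h
    · exact absurd hxy.symm ((hgood x (hsub hx)).2 y h)
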